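/- For all (r, θ) with Σ ≠ 0, sin θ ≠ 0, and r² + a² ≠ 0, the Hartle–Hawking congruence ℓ of the Kerr metric is shear-free: the Newman–Penrose spin coefficient σ_NP = −Σ_{b,c} m^b m^c ∇_c ℓ_b vanishes, where ∇_c ℓ_b = ∂_c (gℓ)_b − Σ_d Γ^d_{cb} (gℓ)_d is the covariant derivative of the lowered vector ℓ_b = (gℓ)_b, Γ are the Levi-Civita connection coefficients of g, and m is the complex Hartle–Hawking tetrad vector. -/

import Mathlib

open scoped BigOperators
open Matrix

/-- `Δ = r² − 2Mr + a²` for the Kerr metric. -/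
noncomputable def kerrΔ (M a r : ℝ) : ℝ := r ^ 2 - 2 * M * r + a ^ 2

/-- `Σ = r² + a² cos²θ` for the Kerr metric. -/
noncomputable def kerrSigma (a r θ : ℝ) : ℝ := r ^ 2 + a ^ 2 * Real.cos θ ^ 2

/-- The Kerr metric in ingoing coordinates `(v, r, θ, φ)` (indices `0,1,2,3`),
determined by the line element
`ds² = −(1 − 2Mr/Σ)(dv − a sin²θ dφ)² + 2(dv − a sin²θ dφ)(dr − a sin²θ dφ)
      + Σ(dθ² + sin²θ dφ²)`. -/
noncomputable def kerrMetric (M a r θ : ℝ) : Matrix (Fin 4) (Fin 4) ℝ :=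
  fun i j =>
    let e1 : Fin 4 → ℝ := ![1, 0, 0, -a * Real.sin θ ^ 2]  -- dv − a sin²θ dφ
    let e2 : Fin 4 → ℝ := ![0, 1, 0, -a * Real.sin θ ^ 2]  -- dr − a sin²θ dφ
    let e3 : Fin 4 → ℝ := ![0, 0, 1, 0]                    -- dθ
    let e4 : Fin 4 → ℝ := ![0, 0, 0, 1]                    -- dφ
    (-(1 - 2 * M * r / kerrSigma a r θ) * e1 i * e1 j
      + (e1 i * e2 j + e2 i * e1 j)
      + kerrSigma a r θ * e3 i * e3 j
      + kerrSigma a r θ * Real.sin θ ^ 2 * e4 i * e4 j)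

/-- The `ℓ` vector of the Hartle–Hawking tetrad:
`ℓ = (1, Δ/(2(r²+a²)), 0, a/(r²+a²))`. -/
noncomputable def ellHH (M a r : ℝ) : Fin 4 → ℝ :=
  ![1, kerrΔ M a r / (2 * (r ^ 2 + a ^ 2)), 0, a / (r ^ 2 + a ^ 2)]

/-- The `n` vector of the Hartle–Hawking tetrad: `n = (0, −(r²+a²)/Σ, 0, 0)`. -/
noncomputable def nHH (a r θ : ℝ) : Fin 4 → ℝ :=
  ![0, -(r ^ 2 + a ^ 2) / kerrSigma a r θ, 0, 0]

/-- The complex `m` vector of the Hartle–Hawking tetrad: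
`m = (1/(√2 (r + i a cos θ))) (i a sin θ, 0, 1, i/sin θ)`. -/
noncomputable def mHH (a r θ : ℝ) : Fin 4 → ℂ :=
  fun i => (1 / (Real.sqrt 2 * ((r : ℂ) + Complex.I * (a : ℂ) * (Real.cos θ : ℂ)))) *
    ![Complex.I * (a : ℂ) * (Real.sin θ : ℂ), 0, 1, Complex.I / (Real.sin θ : ℂ)] i

/-- Partial derivative of a scalar field on `ℝ⁴` in the `a`-th coordinate direction. -/
noncomputable def pderiv4 (f : (Fin 4 → ℝ) → ℝ) (x : Fin 4 → ℝ) (a : Fin 4) : ℝ :=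
  fderiv ℝ f x (Pi.single a 1)

/-- Levi-Civita connection coefficients
`Γ^a_{bc} = (1/2) Σ_d g^{ad} (∂_b g_{dc} + ∂_c g_{bd} − ∂_d g_{bc})` of a metric
field on `ℝ⁴`, with `g⁻¹` the pointwise matrix inverse. -/
noncomputable def Christoffel (g : (Fin 4 → ℝ) → Matrix (Fin 4) (Fin 4) ℝ)
    (x : Fin 4 → ℝ) (a b c : Fin 4) : ℝ :=
  (1 / 2) * ∑ d, (g x)⁻¹ a d *
    (pderiv4 (fun y => g y d c) x b + pderiv4 (fun y => g y b d) x c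
      - pderiv4 (fun y => g y b c) x d)

/-- The Kerr metric as a field on `ℝ⁴` in ingoing coordinates `x = (v, r, θ, φ)`. -/
noncomputable def kerrField (M a : ℝ) (x : Fin 4 → ℝ) : Matrix (Fin 4) (Fin 4) ℝ :=
  kerrMetric M a (x 1) (x 2)

/-- The Hartle–Hawking vector `ℓ` as a field on `ℝ⁴`. -/
noncomputable def ellField (M a : ℝ) (x : Fin 4 → ℝ) : Fin 4 → ℝ :=
  ellHH M a (x 1)


/-- Covariant derivative of the lowered Hartle–Hawking vector, `∇_c ℓ_b` with
`ℓ_b = (gℓ)_b`: `∇_c ℓ_b = ∂_c (gℓ)_b − Σ_d Γ^d_{cb} (gℓ)_d`. -/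
noncomputable def covLowEll (M a : ℝ) (x : Fin 4 → ℝ) (c b : Fin 4) : ℝ :=
  pderiv4 (fun y => (kerrField M a y).mulVec (ellField M a y) b) x c
    - ∑ d, Christoffel (kerrField M a) x d c b *
        (kerrField M a x).mulVec (ellField M a x) d

theorem pderiv4_eq_lineDeriv {f : (Fin 4 → ℝ) → ℝ} {x : Fin 4 → ℝ}
    (hf : DifferentiableAt ℝ f x) (c : Fin 4) :
    pderiv4 f x c = lineDeriv ℝ f x (Pi.single c 1) :=
  hf.lineDeriv_eq_fderiv.symm

/-- Lowering the upper index of the Levi-Civita coefficients gives the Christoffel symbols of the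
first kind. -/
theorem sum_Christoffel_mul_mulVec (g : (Fin 4 → ℝ) → Matrix (Fin 4) (Fin 4) ℝ)
    (x ell : Fin 4 → ℝ) (hsymm : (g x).IsSymm) (hdet : IsUnit (g x).det) (b c : Fin 4) :
    ∑ d, Christoffel g x d c b * (g x *ᵥ ell) d =
      ∑ d, (1 / 2) * (pderiv4 (fun y => g y d b) x c + pderiv4 (fun y => g y c d) x b
        - pderiv4 (fun y => g y c b) x d) * ell d := by
  set w : Fin 4 → ℝ := fun d => pderiv4 (fun y => g y d b) x c + pderiv4 (fun y => g y c d) x b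
        - pderiv4 (fun y => g y c b) x d
  have hL : ∀ d, Christoffel g x d c b = (1 / 2) * ((g x)⁻¹ *ᵥ w) d := fun d => rfl
  have key : ((g x)⁻¹ *ᵥ w) ⬝ᵥ (g x *ᵥ ell) = w ⬝ᵥ ell := by
    rw [dotProduct_mulVec, ← mulVec_transpose, hsymm.eq, mulVec_mulVec, mul_nonsing_inv _ hdet,
      one_mulVec]
  simp only [hL, mul_assoc, ← Finset.mul_sum]
  exact congrArg _ key

/-- The covariant derivative of a lowered vector field in terms of derivatives of the metric and
of the vector field. -/
theorem pderiv4_mulVec_sub_sum_Christoffel (g : (Fin 4 → ℝ) → Matrix (Fin 4) (Fin 4) ℝ)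
    (ell : (Fin 4 → ℝ) → Fin 4 → ℝ) (x : Fin 4 → ℝ)
    (hg : ∀ i j, DifferentiableAt ℝ (fun y => g y i j) x)
    (hell : ∀ i, DifferentiableAt ℝ (fun y => ell y i) x)
    (hsymm : ∀ y, (g y).IsSymm) (hdet : IsUnit (g x).det) (c b : Fin 4) :
    pderiv4 (fun y => (g y *ᵥ ell y) b) x c
        - ∑ d, Christoffel g x d c b * (g x *ᵥ ell x) d =
      ∑ d, (g x b d * pderiv4 (fun y => ell y d) x c
        + (1 / 2) * ell x d * (pderiv4 (fun y => g y b d) x c - pderiv4 (fun y => g y c d) x b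
          + pderiv4 (fun y => g y c b) x d)) := by
  have hprod : pderiv4 (fun y => (g y *ᵥ ell y) b) x c =
      ∑ d, (g x b d * pderiv4 (fun y => ell y d) x c
        + ell x d * pderiv4 (fun y => g y b d) x c) := by
    have h : HasFDerivAt (fun y => ∑ d, g y b d * ell y d) _ x :=
      HasFDerivAt.fun_sum fun d _ => (hg b d).hasFDerivAt.mul (hell d).hasFDerivAt
    have h' := congrArg (fun L => L (Pi.single c 1)) h.fderiv
    simpa [pderiv4, mulVec, dotProduct] using h'
  rw [hprod, sum_Christoffel_mul_mulVec g x (ell x) (hsymm x) hdet, ← Finset.sum_sub_distrib]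
  refine Finset.sum_congr rfl fun d _ => ?_
  rw [show (fun y => g y d b) = fun y => g y b d from funext fun y => (hsymm y).apply b d]
  ring

theorem kerrMetric_isSymm (M a r θ : ℝ) : (kerrMetric M a r θ).IsSymm := by
  ext i j
  simp only [transpose_apply, kerrMetric]
  ring

theorem det_kerrMetric (M a r θ : ℝ) :
    (kerrMetric M a r θ).det = -(kerrSigma a r θ ^ 2 * Real.sin θ ^ 2) := by
  generalize hk : 1 - 2 * M * r / kerrSigma a r θ = k
  simp [det_succ_row_zero, Fin.sum_univ_succ, kerrMetric, Fin.succAbove, hk]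
  ring

theorem differentiableAt_kerrField (M a : ℝ) (x : Fin 4 → ℝ)
    (hSig : kerrSigma a (x 1) (x 2) ≠ 0) (i j : Fin 4) :
    DifferentiableAt ℝ (fun y => kerrField M a y i j) x := by
  unfold kerrSigma at hSig
  have hvec : ∀ k (u : ℝ), DifferentiableAt ℝ
      (fun y : Fin 4 → ℝ => (![u, 1 - u, 0, -a * Real.sin (y 2) ^ 2] : Fin 4 → ℝ) k) x := by
    intro k u
    fin_cases k <;> simp <;> fun_prop
  have h1 := fun k => hvec k 1
  have h2 := fun k => hvec k 0
  simp only [sub_self, sub_zero] at h1 h2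
  simp only [kerrField, kerrMetric, kerrSigma]
  fun_prop (disch := assumption)

theorem differentiableAt_ellField (M a : ℝ) (x : Fin 4 → ℝ) (hra : x 1 ^ 2 + a ^ 2 ≠ 0)
    (i : Fin 4) : DifferentiableAt ℝ (fun y => ellField M a y i) x := by
  have hra2 : 2 * (x 1 ^ 2 + a ^ 2) ≠ 0 := mul_ne_zero two_ne_zero hra
  fin_cases i <;> simp [ellField, ellHH, kerrΔ] <;> fun_prop (disch := assumption)

theorem pderiv4_ellField_eq_zero (M a : ℝ) (x : Fin 4 → ℝ) (hra : x 1 ^ 2 + a ^ 2 ≠ 0)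
    (d : Fin 4) {c : Fin 4} (hc : c ≠ 1) : pderiv4 (fun y => ellField M a y d) x c = 0 := by
  rw [pderiv4_eq_lineDeriv (differentiableAt_ellField M a x hra d)]
  simp [lineDeriv, ellField, Pi.single_eq_of_ne hc.symm]

theorem pderiv4_kerrField_eq_zero (M a : ℝ) (x : Fin 4 → ℝ)
    (hSig : kerrSigma a (x 1) (x 2) ≠ 0) (i j : Fin 4) {d : Fin 4} (h1 : d ≠ 1) (h2 : d ≠ 2) :
    pderiv4 (fun y => kerrField M a y i j) x d = 0 := by
  rw [pderiv4_eq_lineDeriv (differentiableAt_kerrField M a x hSig i j)]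
  simp [lineDeriv, kerrField, Pi.single_eq_of_ne h1.symm, Pi.single_eq_of_ne h2.symm]

/-- The radial derivative of the Kerr metric is a combination of `(dv − a sin²θ dφ)²` and
`dθ² + sin²θ dφ²`. -/
theorem exists_pderiv4_kerrField_one (M a : ℝ) (x : Fin 4 → ℝ)
    (hSig : kerrSigma a (x 1) (x 2) ≠ 0) :
    ∃ p q : ℝ, ∀ i j, pderiv4 (fun y => kerrField M a y i j) x 1 =
      p * (![1, 0, 0, -a * Real.sin (x 2) ^ 2] i * ![1, 0, 0, -a * Real.sin (x 2) ^ 2] j)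
      + q * (![0, 0, 1, 0] i * ![0, 0, 1, 0] j
        + Real.sin (x 2) ^ 2 * (![0, 0, 0, 1] i * ![0, 0, 0, 1] j)) := by
  have hS : DifferentiableAt ℝ (fun t => kerrSigma a (x 1 + t) (x 2)) 0 := by
    unfold kerrSigma; fun_prop
  have hk : DifferentiableAt ℝ
      (fun t => -(1 - 2 * M * (x 1 + t) / kerrSigma a (x 1 + t) (x 2))) 0 := by
    have : kerrSigma a (x 1 + 0) (x 2) ≠ 0 := by simpa using hSig
    fun_prop (disch := assumption)
  refine ⟨deriv (fun t => -(1 - 2 * M * (x 1 + t) / kerrSigma a (x 1 + t) (x 2))) 0,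
    deriv (fun t => kerrSigma a (x 1 + t) (x 2)) 0, fun i j => ?_⟩
  rw [pderiv4_eq_lineDeriv (differentiableAt_kerrField M a x hSig i j)]
  simp only [lineDeriv, kerrField, kerrMetric, Pi.add_apply, Pi.smul_apply, Pi.single_eq_same,
    smul_eq_mul, mul_one, Pi.single_eq_of_ne (show (2 : Fin 4) ≠ 1 by decide), mul_zero,
    add_zero]
  refine (((((hk.hasDerivAt.mul_const _).mul_const _).add_const _).add
    ((hS.hasDerivAt.mul_const _).mul_const _)).add
    (((hS.hasDerivAt.mul_const _).mul_const _).mul_const _)).deriv.trans ?_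
  ring

/-- Wherever `Σ ≠ 0`, `sin θ ≠ 0`, and `r² + a² ≠ 0`, the
Hartle–Hawking congruence `ℓ` of the Kerr metric is shear-free: the Newman–Penrose
spin coefficient `σ_NP = −Σ_{b,c} m^b m^c ∇_c ℓ_b` vanishes. -/
theorem ellHH_shear_free (M a : ℝ) (x : Fin 4 → ℝ)
    (hSig : kerrSigma a (x 1) (x 2) ≠ 0) (hs : Real.sin (x 2) ≠ 0)
    (hra : (x 1) ^ 2 + a ^ 2 ≠ 0) :
    -∑ b, ∑ c, mHH a (x 1) (x 2) b * mHH a (x 1) (x 2) c * (covLowEll M a x c b : ℂ)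
      = 0 := by
  have hdet : IsUnit (kerrField M a x).det := by
    rw [kerrField, det_kerrMetric]
    exact (neg_ne_zero.2 (mul_ne_zero (pow_ne_zero 2 hSig) (pow_ne_zero 2 hs))).isUnit
  have hcov (c b : Fin 4) : covLowEll M a x c b = _ :=
    pderiv4_mulVec_sub_sum_Christoffel (kerrField M a) (ellField M a) x
      (differentiableAt_kerrField M a x hSig) (differentiableAt_ellField M a x hra)
      (fun y => kerrMetric_isSymm M a (y 1) (y 2)) hdet c b
  obtain ⟨p, q, hpq⟩ := exists_pderiv4_kerrField_one M a x hSig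
  have hell2 : ellField M a x 2 = 0 := rfl
  have hm1 : mHH a (x 1) (x 2) 1 = 0 := by simp [mHH]
  have hs' : (Real.sin (x 2) : ℂ) ≠ 0 := Complex.ofReal_ne_zero.2 hs
  have hm0 : mHH a (x 1) (x 2) 0 = a * Real.sin (x 2) ^ 2 * mHH a (x 1) (x 2) 3 := by
    simp only [mHH, cons_val]
    field_simp
  have hm2 : mHH a (x 1) (x 2) 2 ^ 2 = -(Real.sin (x 2) ^ 2 * mHH a (x 1) (x 2) 3 ^ 2) := by
    simp only [mHH, cons_val, mul_pow, div_pow, Complex.I_sq]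
    field_simp
  have hd := fun (d c : Fin 4) (hc : c ≠ 1) => pderiv4_ellField_eq_zero M a x hra d hc
  have h0 := fun i j => pderiv4_kerrField_eq_zero M a x hSig i j (d := 0) (by decide) (by decide)
  have h3 := fun i j => pderiv4_kerrField_eq_zero M a x hSig i j (d := 3) (by decide) (by decide)
  simp only [hcov, Fin.sum_univ_four, hm1, zero_mul, mul_zero, add_zero, hell2, h0, h3,
    hpq, hd _ 0 (by decide), hd _ 2 (by decide), hd _ 3 (by decide), cons_val, hm0]
  push_cast at hm2 ⊢
  linear_combination (-(1 / 2) * (ellField M a x 1 : ℂ) * q) * hm2
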